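/- Let K be a field of characteristic zero, r ≥ 1 an integer, A an r×r matrix with entries in K((t)), and h ∈ K((t)) a nonzero Laurent series. Define the K-linear endomorphism T of K((t))^r by T(f) = h · (f' + A·f), where f' denotes the componentwise derivative. Then the kernel of T and the cokernel K((t))^r / T(K((t))^r) are finite-dimensional K-vector spaces, and dim_K ker(T) = dim_K coker(T). (In the language of the paper: the operator ∇_{K((t))/K, ν} = ν⁻¹ ∘ ∇_{K((t))/K} attached to a relative connection and a nonzero relative differential form ν is a Fredholm endomorphism with χ(∇_{K((t))/K, ν}) = 0.) -/

import Mathlib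

/-- The formal derivative of a Laurent series `f = Σₙ aₙ tⁿ ∈ K((t))`,
namely `f' = Σₙ n aₙ tⁿ⁻¹`. -/
noncomputable def lsDeriv {K : Type*} [Field K] (f : LaurentSeries K) : LaurentSeries K where
  coeff n := (n + 1) • f.coeff (n + 1)
  isPWO_support' := by
    apply Set.IsPWO.mono (f.isPWO_support'.image_of_monotone (f := fun n : ℤ => n - 1)
      (fun x y hxy => by simpa using hxy))
    intro n hn
    have : f.coeff (n + 1) ≠ 0 := by
      intro h
      simp [Function.mem_support, h] at hn
    exact ⟨n + 1, this, by ring⟩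

instance ls_isScalarTower (K : Type*) [Field K] :
    IsScalarTower K (LaurentSeries K) (LaurentSeries K) :=
  @IsScalarTower.right K (LaurentSeries K) _ _ HahnSeries.instAlgebra

instance ls_smulCommClass (K : Type*) [Field K] :
    SMulCommClass K (LaurentSeries K) (LaurentSeries K) :=
  @Algebra.to_smulCommClass K (LaurentSeries K) _ _ HahnSeries.instAlgebra

/-- `T` is bijective up to a finite-rank perturbation. -/
def IsFred {K V W : Type*} [Field K] [AddCommGroup V] [Module K V] [AddCommGroup W] [Module K W]
    (T : V →ₗ[K] W) : Prop :=
  ∃ R : V →ₗ[K] W, FiniteDimensional K (LinearMap.range R) ∧ Function.Bijective (T - R)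

theorem isFred_index {K V : Type*} [Field K] [AddCommGroup V] [Module K V]
    (T : V →ₗ[K] V) (hT : IsFred T) :
    FiniteDimensional K (LinearMap.ker T) ∧
      FiniteDimensional K (V ⧸ LinearMap.range T) ∧
      Module.finrank K (LinearMap.ker T) = Module.finrank K (V ⧸ LinearMap.range T) := by
  obtain ⟨R, hR, hS⟩ := hT
  let S : V ≃ₗ[K] V := LinearEquiv.ofBijective (T - R) hS
  have hSa : ∀ v, S v = T v - R v := fun v => rfl
  let U := LinearMap.range R
  let W : Submodule K V := U.comap (S : V →ₗ[K] V)
  let e : W ≃ₗ[K] U := LinearEquiv.ofSubmodule' S U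
  have : FiniteDimensional K U := hR
  have : FiniteDimensional K W := LinearEquiv.finiteDimensional e.symm
  have hWU : ∀ w ∈ W, T w ∈ U := by
    intro w hw
    have h1 : S w ∈ U := hw
    have h2 : R w ∈ U := ⟨w, rfl⟩
    have := U.add_mem h1 h2
    rwa [hSa, sub_add_cancel] at this
  let TW : W →ₗ[K] U := T.restrict hWU
  have hkW : LinearMap.ker T ≤ W := by
    intro v hv
    have hv' : T v = 0 := hv
    change S v ∈ U
    rw [hSa, hv', zero_sub]
    exact U.neg_mem ⟨v, rfl⟩
  let k : LinearMap.ker TW ≃ₗ[K] LinearMap.ker T :=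
    LinearEquiv.ofBijective
      ((W.subtype ∘ₗ (LinearMap.ker TW).subtype).codRestrict (LinearMap.ker T) (by
        rintro ⟨w, hw⟩
        have : TW w = 0 := hw
        have := congrArg Subtype.val this
        exact this))
      (by
        constructor
        · rintro ⟨⟨a, _⟩, _⟩ ⟨⟨b, _⟩, _⟩ h
          have := congrArg Subtype.val h
          simpa using this
        · rintro ⟨v, hv⟩
          refine ⟨⟨⟨v, hkW hv⟩, ?_⟩, rfl⟩
          apply Subtype.ext
          exact hv)
  let q0 : U →ₗ[K] (V ⧸ LinearMap.range T) := (LinearMap.range T).mkQ ∘ₗ U.subtype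
  have hq0s : Function.Surjective q0 := by
    intro y
    obtain ⟨v, rfl⟩ := Submodule.mkQ_surjective _ y
    obtain ⟨x, rfl⟩ := S.surjective v
    refine ⟨-⟨R x, ⟨x, rfl⟩⟩, ?_⟩
    change (LinearMap.range T).mkQ (-(R x)) = _
    rw [← sub_eq_zero, ← map_sub]
    simp only [Submodule.mkQ_apply, Submodule.Quotient.mk_eq_zero]
    refine ⟨-x, ?_⟩
    rw [hSa, map_neg]; abel
  have hq0k : LinearMap.ker q0 = LinearMap.range TW := by
    ext ⟨u, hu⟩
    constructor
    · intro h
      have h' : u ∈ LinearMap.range T := by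
        have : (LinearMap.range T).mkQ u = 0 := h
        simpa using this
      obtain ⟨v, hv⟩ := h'
      refine ⟨⟨v, ?_⟩, Subtype.ext hv⟩
      change S v ∈ U
      rw [hSa, hv]
      exact U.sub_mem hu ⟨v, rfl⟩
    · rintro ⟨w, hw⟩
      have hw' : T w = u := congrArg Subtype.val hw
      change (LinearMap.range T).mkQ u = 0
      simp only [Submodule.mkQ_apply, Submodule.Quotient.mk_eq_zero]
      exact ⟨w, hw'⟩
  have h1 : FiniteDimensional K (LinearMap.ker T) := LinearEquiv.finiteDimensional k
  have h2 : FiniteDimensional K (V ⧸ LinearMap.range T) := Module.Finite.of_surjective q0 hq0s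
  refine ⟨h1, h2, ?_⟩
  have a1 := LinearMap.finrank_range_add_finrank_ker TW
  have a2 := LinearMap.finrank_range_add_finrank_ker q0
  rw [LinearMap.range_eq_top.2 hq0s, hq0k, finrank_top] at a2
  have a3 := LinearEquiv.finrank_eq k
  have a4 := LinearEquiv.finrank_eq e
  omega

theorem isFred_extension {K N V Q : Type*} [Field K] [AddCommGroup N] [Module K N]
    [AddCommGroup V] [Module K V] [AddCommGroup Q] [Module K Q]
    (i : N →ₗ[K] V) (p : V →ₗ[K] Q) (hi : Function.Injective i) (hp : Function.Surjective p)
    (hip : ∀ v, p v = 0 ↔ ∃ n, i n = v)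
    (TN : N →ₗ[K] N) (T : V →ₗ[K] V) (TQ : Q →ₗ[K] Q)
    (h1 : ∀ n, T (i n) = i (TN n)) (h2 : ∀ v, p (T v) = TQ (p v))
    (hN : IsFred TN) (hQ : IsFred TQ) : IsFred T := by
  obtain ⟨RN, fN, bN⟩ := hN
  obtain ⟨RQ, fQ, bQ⟩ := hQ
  obtain ⟨ρ, hρ⟩ := LinearMap.exists_leftInverse_of_injective i (LinearMap.ker_eq_bot.2 hi)
  obtain ⟨σ, hσ⟩ := LinearMap.exists_rightInverse_of_surjective p (LinearMap.range_eq_top.2 hp)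
  have hρ' : ∀ n, ρ (i n) = n := fun n => LinearMap.congr_fun hρ n
  have hσ' : ∀ n, p (σ n) = n := fun n => LinearMap.congr_fun hσ n
  have hpi : ∀ n, p (i n) = 0 := fun n => (hip _).2 ⟨n, rfl⟩
  let R : V →ₗ[K] V := i ∘ₗ RN ∘ₗ ρ + σ ∘ₗ RQ ∘ₗ p
  have hR : ∀ v, R v = i (RN (ρ v)) + σ (RQ (p v)) := fun v => rfl
  have e1 : ∀ n, (T - R) (i n) = i ((TN - RN) n) := by
    intro n
    simp [hR, h1, hρ', hpi]
  have e2 : ∀ v, p ((T - R) v) = (TQ - RQ) (p v) := by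
    intro v
    simp [hR, h2, hσ', hpi]
  refine ⟨R, ?_, ?_, ?_⟩
  · have : LinearMap.range R ≤ (LinearMap.range RN).map i ⊔ (LinearMap.range RQ).map σ := by
      rintro _ ⟨v, rfl⟩
      exact Submodule.add_mem_sup ⟨_, ⟨_, rfl⟩, rfl⟩ ⟨_, ⟨_, rfl⟩, rfl⟩
    exact Submodule.finiteDimensional_of_le this
  · rw [injective_iff_map_eq_zero]
    intro v hv
    have := e2 v
    rw [hv, map_zero] at this
    have : p v = 0 := (injective_iff_map_eq_zero _).1 bQ.1 _ this.symm
    obtain ⟨n, rfl⟩ := (hip v).1 this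
    rw [e1] at hv
    have := hi (hv.trans (map_zero i).symm)
    rw [(injective_iff_map_eq_zero _).1 bN.1 _ this, map_zero]
  · intro y
    obtain ⟨q, hq⟩ := bQ.2 (p y)
    obtain ⟨x, rfl⟩ := hp q
    rw [← e2] at hq
    have : p (y - (T - R) x) = 0 := by rw [map_sub, hq, sub_self]
    obtain ⟨n, hn⟩ := (hip _).1 this
    obtain ⟨m, rfl⟩ := bN.2 n
    refine ⟨i m + x, ?_⟩
    rw [map_add, e1, hn, sub_add_cancel]

/-- The Euler derivation `t d/dt`. -/
noncomputable def eulerD (K : Type*) [Field K] : LaurentSeries K →ₗ[K] LaurentSeries K where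
  toFun f :=
    { coeff := fun n => (n : K) * f.coeff n
      isPWO_support' := f.isPWO_support'.mono (by
        intro n hn h0
        apply hn
        simp [h0]) }
  map_add' f g := by
    ext n
    simp [mul_add]
  map_smul' c f := by
    ext n
    simp [mul_left_comm]

theorem eulerD_coeff {K : Type*} [Field K] (f : LaurentSeries K) (n : ℤ) :
    (eulerD K f).coeff n = (n : K) * f.coeff n := rfl

theorem eulerD_mul {K : Type*} [Field K] (f g : LaurentSeries K) :
    eulerD K (f * g) = eulerD K f * g + f * eulerD K g := by
  have s : ∀ u : LaurentSeries K, (eulerD K u).support ⊆ u.support := by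
    intro u n hn h0
    apply hn
    simp [eulerD_coeff, h0]
  ext n
  rw [HahnSeries.coeff_add, eulerD_coeff, HahnSeries.coeff_mul,
    HahnSeries.coeff_mul_left' f.isPWO_support (s f),
    HahnSeries.coeff_mul_right' g.isPWO_support (s g), Finset.mul_sum, ← Finset.sum_add_distrib]
  refine Finset.sum_congr rfl ?_
  rintro ⟨a, b⟩ hab
  have : a + b = n := (Finset.mem_addAntidiagonal.1 hab).2.2
  subst this
  simp only [eulerD_coeff]
  push_cast
  ring

theorem ls_mul_lead {K : Type*} [Field K] (x y : LaurentSeries K) (p q : ℤ)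
    (hx : ∀ j < p, x.coeff j = 0) (hy : ∀ j < q, y.coeff j = 0) :
    (∀ j < p + q, (x * y).coeff j = 0) ∧ (x * y).coeff (p + q) = x.coeff p * y.coeff q := by
  constructor
  · intro j hj
    rw [HahnSeries.coeff_mul]
    apply Finset.sum_eq_zero
    rintro ⟨a, b⟩ hab
    have : a + b = j := (Finset.mem_addAntidiagonal.1 hab).2.2
    rcases lt_or_ge a p with h | h
    · simp [hx a h]
    · simp [hy b (by omega)]
  · rw [HahnSeries.coeff_mul, Finset.sum_eq_single (p, q)]
    · rintro ⟨a, b⟩ hab hne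
      have h0 : a + b = p + q := (Finset.mem_addAntidiagonal.1 hab).2.2
      rcases lt_or_ge a p with h | h
      · simp [hx a h]
      · have : b < q := by
          by_contra hb
          apply hne
          ext <;> simp <;> omega
        simp [hy b this]
    · intro h
      by_contra hc
      apply h
      rw [Finset.mem_addAntidiagonal]
      exact ⟨left_ne_zero_of_mul hc, right_ne_zero_of_mul hc, rfl⟩

theorem triangular_bijective {K : Type*} [Field K]
    (M : LaurentSeries K →ₗ[K] LaurentSeries K) (l : ℤ) (d : ℤ → K) (hd : ∀ k, d k ≠ 0)
    (h1 : ∀ k z, (∀ j < k, z.coeff j = 0) → ∀ j < k + l, (M z).coeff j = 0)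
    (h2 : ∀ k z, (∀ j < k, z.coeff j = 0) → (M z).coeff (k + l) = d k * z.coeff k) :
    Function.Bijective M := by
  constructor
  · rw [injective_iff_map_eq_zero]
    intro z hz
    by_contra hne
    have h := h2 z.order z (fun j hj => HahnSeries.coeff_eq_zero_of_lt_order hj)
    rw [hz, HahnSeries.coeff_zero] at h
    exact mul_ne_zero (hd _) (HahnSeries.coeff_order_eq_zero.not.2 hne) h.symm
  · intro g
    obtain ⟨N, hN⟩ : ∃ N : ℤ, ∀ j < N + l, g.coeff j = 0 :=
      ⟨g.order - l, fun j hj => HahnSeries.coeff_eq_zero_of_lt_order (by linarith)⟩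
    let st : ℕ → LaurentSeries K := fun n => Nat.rec 0 (fun i z =>
      z + HahnSeries.single (N + (i : ℤ)) ((d (N + i))⁻¹ * (g - M z).coeff (N + i + l))) n
    have st0 : st 0 = 0 := rfl
    have stS : ∀ i : ℕ, st (i + 1) = st i + HahnSeries.single (N + (i : ℤ))
        ((d (N + i))⁻¹ * (g - M (st i)).coeff (N + i + l)) := fun i => rfl
    have hst : ∀ i : ℕ, ∀ j < N + i + l, (g - M (st i)).coeff j = 0 := by
      intro i
      induction i with
      | zero =>
        intro j hj
        rw [st0, map_zero, sub_zero]
        exact hN j (by simpa using hj)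
      | succ i ih =>
        intro j hj
        rw [stS, map_add, ← sub_sub, HahnSeries.coeff_sub]
        have hs : ∀ j < N + (i : ℤ), (HahnSeries.single (N + (i : ℤ))
          ((d (N + i))⁻¹ * (g - M (st i)).coeff (N + i + l))).coeff j = 0 := fun j hj =>
            HahnSeries.coeff_single_of_ne hj.ne
        rcases lt_or_ge j (N + i + l) with h | h
        · rw [ih j h, h1 _ _ hs j h, sub_zero]
        · have : j = N + i + l := by push_cast at hj; omega
          subst this
          rw [h2 _ _ hs, HahnSeries.coeff_single_same, mul_inv_cancel_left₀ (hd _), sub_self]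
    have stc : ∀ i j : ℕ, ∀ m : ℤ, m < N + i → (st (i + j)).coeff m = (st i).coeff m := by
      intro i j m hm
      induction j with
      | zero => rfl
      | succ j ih =>
        rw [← add_assoc, stS, HahnSeries.coeff_add, ih, HahnSeries.coeff_single_of_ne, add_zero]
        push_cast; omega
    have stlow : ∀ i : ℕ, ∀ m < N, (st i).coeff m = 0 := by
      intro i m hm
      have := stc 0 i m (by simpa using hm)
      rw [zero_add] at this
      rw [this, st0, HahnSeries.coeff_zero]
    let z : LaurentSeries K := HahnSeries.ofSuppBddBelow
      (fun m => (st (m - N + 1).toNat).coeff m) ⟨N, by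
        intro m hm
        by_contra hc
        exact hm (stlow _ _ (not_le.1 hc))⟩
    have hz : ∀ i : ℕ, ∀ m < N + (i : ℤ), (z - st i).coeff m = 0 := by
      intro i m hm
      rw [HahnSeries.coeff_sub]
      change (st (m - N + 1).toNat).coeff m - _ = 0
      rcases lt_or_ge m N with h | h
      · rw [stlow _ _ h, stlow _ _ h, sub_zero]
      · obtain ⟨j, hj⟩ := Nat.exists_eq_add_of_le (show (m - N + 1).toNat ≤ i by omega)
        rw [hj, stc _ _ _ (by omega), sub_self]
    refine ⟨z, ?_⟩
    rw [← sub_eq_zero]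
    ext m
    obtain ⟨i, hi⟩ : ∃ i : ℕ, m < N + i + l := ⟨(m - N - l + 1).toNat, by omega⟩
    have a := h1 _ _ (hz i) m hi
    have b := hst i m hi
    rw [map_sub] at a
    rw [HahnSeries.coeff_sub] at a b ⊢
    rw [HahnSeries.coeff_zero]
    linear_combination a - b

theorem eulerD_pow_coeff {K : Type*} [Field K] (i : ℕ) (f : LaurentSeries K) (n : ℤ) :
    (((eulerD K) ^ i) f).coeff n = (n : K) ^ i * f.coeff n := by
  induction i with
  | zero => simp
  | succ i ih =>
    rw [pow_succ', Module.End.mul_apply, eulerD_coeff, ih]; ring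

theorem isFred_scalar {K : Type*} [Field K] [CharZero K]
    (L : LaurentSeries K →ₗ[K] LaurentSeries K) (n : ℕ) (b : ℕ → LaurentSeries K)
    (hb : b n ≠ 0)
    (hL : ∀ z, L z = ∑ i ∈ Finset.range (n + 1), b i * ((eulerD K) ^ i) z) : IsFred L := by
  classical
  obtain ⟨i0, hi0, hmin⟩ := Finset.exists_min_image
    ((Finset.range (n + 1)).filter (fun i => b i ≠ 0)) (fun i => (b i).order)
    ⟨n, by simp [hb]⟩
  rw [Finset.mem_filter] at hi0
  set l := (b i0).order with hl
  have hlow : ∀ i ∈ Finset.range (n + 1), ∀ j < l, (b i).coeff j = 0 := by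
    intro i hi j hj
    by_cases h : b i = 0
    · simp [h]
    · exact HahnSeries.coeff_eq_zero_of_lt_order
        (lt_of_lt_of_le hj (hmin i (Finset.mem_filter.2 ⟨hi, h⟩)))
  have hne : (b i0).coeff l ≠ 0 := HahnSeries.coeff_order_eq_zero.not.2 hi0.2
  let P : Polynomial K :=
    ∑ i ∈ Finset.range (n + 1), Polynomial.C ((b i).coeff l) * Polynomial.X ^ i
  have hP : P ≠ 0 := by
    intro h
    have : P.coeff i0 = (b i0).coeff l := by
      simp only [P, Polynomial.finsetSum_coeff, Polynomial.coeff_C_mul_X_pow]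
      rw [Finset.sum_ite_eq]
      simp only [hi0.1, if_true]
    rw [h, Polynomial.coeff_zero] at this
    exact hne this.symm
  have hPe : ∀ k : ℤ, P.eval (k : K) =
      ∑ i ∈ Finset.range (n + 1), (b i).coeff l * (k : K) ^ i := by
    intro k
    simp [P, Polynomial.eval_finsetSum]
  have hZ : {m : ℤ | P.eval (m : K) = 0}.Finite := by
    have : (P.rootSet K).Finite := Polynomial.rootSet_finite P K
    refine Set.Finite.subset (Set.Finite.preimage (f := fun m : ℤ => (m : K))
      (Int.cast_injective.injOn) (P.roots.toFinset.finite_toSet)) ?_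
    intro m hm
    simpa [hP] using hm
  let Z := hZ.toFinset
  have hZm : ∀ m, m ∈ Z ↔ P.eval (m : K) = 0 := by intro m; simp [Z]
  let R : LaurentSeries K →ₗ[K] LaurentSeries K :=
    -∑ m ∈ Z, (HahnSeries.single.linearMap (R := K) (m + l)) ∘ₗ (HahnSeries.coeff.linearMap m)
  have hRa : ∀ z, R z = -∑ m ∈ Z, HahnSeries.single (m + l) (z.coeff m) := by
    intro z
    simp only [R, LinearMap.neg_apply, LinearMap.sum_apply, LinearMap.comp_apply]
    rfl
  have hRc : ∀ z k, (R z).coeff (k + l) = -(if k ∈ Z then z.coeff k else 0) := by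
    intro z k
    rw [hRa, HahnSeries.coeff_neg, HahnSeries.coeff_sum]
    congr 1
    simp only [HahnSeries.coeff_single, add_left_inj]
    rw [Finset.sum_ite_eq]
  have hlead : ∀ k z, (∀ j < k, z.coeff j = 0) → ∀ i ∈ Finset.range (n + 1),
      (∀ j < l + k, (b i * ((eulerD K) ^ i) z).coeff j = 0) ∧
      (b i * ((eulerD K) ^ i) z).coeff (l + k) = (b i).coeff l * ((k : K) ^ i * z.coeff k) := by
    intro k z hz i hi
    rw [← eulerD_pow_coeff]
    refine ls_mul_lead _ _ _ _ (hlow i hi) ?_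
    intro j hj
    rw [eulerD_pow_coeff, hz j hj, mul_zero]
  refine ⟨R, ?_, ?_⟩
  · have : LinearMap.range R ≤ Submodule.span K
        (↑(Z.image (fun m => (HahnSeries.single (m + l) (1 : K) : LaurentSeries K))) :
          Set (LaurentSeries K)) := by
      rintro _ ⟨z, rfl⟩
      rw [hRa]
      refine Submodule.neg_mem _ (Submodule.sum_mem _ fun m hm => ?_)
      have : (HahnSeries.single (m + l) (z.coeff m) : LaurentSeries K) =
          z.coeff m • HahnSeries.single (m + l) (1 : K) := by
        ext j
        simp [HahnSeries.coeff_single]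
      rw [this]
      refine Submodule.smul_mem _ _ (Submodule.subset_span ?_)
      exact Finset.mem_coe.2 (Finset.mem_image_of_mem _ hm)
    have hfd := FiniteDimensional.span_finset K
      (Z.image (fun m => (HahnSeries.single (m + l) (1 : K) : LaurentSeries K)))
    exact Submodule.finiteDimensional_of_le this
  · refine triangular_bijective (L - R) l
      (fun k => P.eval (k : K) + if k ∈ Z then 1 else 0) ?_ ?_ ?_
    · intro k
      by_cases hk : k ∈ Z
      · simp [hk, (hZm k).1 hk]
      · simpa [hk] using fun h => hk ((hZm k).2 h)
    · intro k z hz j hj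
      rw [LinearMap.sub_apply, HahnSeries.coeff_sub, hL, HahnSeries.coeff_sum]
      rw [Finset.sum_eq_zero (fun i hi => (hlead k z hz i hi).1 j (by omega))]
      obtain ⟨m, rfl⟩ : ∃ m, j = m + l := ⟨j - l, by ring⟩
      rw [hRc, hz m (by omega)]
      simp
    · intro k z hz
      rw [LinearMap.sub_apply, HahnSeries.coeff_sub, hL, HahnSeries.coeff_sum, hRc, hPe]
      rw [add_mul, Finset.sum_mul, sub_neg_eq_add]
      congr 1
      · exact Finset.sum_congr rfl fun i hi => by
          rw [add_comm k l, (hlead k z hz i hi).2]; ring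
      · split_ifs <;> simp

/-- Extension by zero of a finite tuple. -/
def extZ {F : Type*} [Zero F] {n : ℕ} (f : Fin n → F) (j : ℕ) : F :=
  if h : j < n then f ⟨j, h⟩ else 0

theorem extZ_fin {F : Type*} [Zero F] {n : ℕ} (f : Fin n → F) (j : Fin n) :
    extZ f j = f j := by simp [extZ]

/-- The (reversed) companion operator. -/
noncomputable def compT (K : Type*) [Field K] (n : ℕ) (a : ℕ → LaurentSeries K) :
    (Fin n → LaurentSeries K) →ₗ[K] (Fin n → LaurentSeries K) where
  toFun f j := eulerD K (f j) + extZ f (j + 1) + a j * extZ f 0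
  map_add' f g := by
    have : ∀ i, extZ (f + g) i = extZ f i + extZ g i := by
      intro i; unfold extZ; split_ifs <;> simp
    funext j
    simp only [this, Pi.add_apply, map_add]
    ring
  map_smul' c f := by
    have : ∀ i, extZ (c • f) i = c • extZ f i := by
      intro i; unfold extZ; split_ifs <;> simp
    funext j
    simp only [this, Pi.smul_apply, map_smul, RingHom.id_apply, smul_add, mul_smul_comm]

theorem compT_apply {K : Type*} [Field K] (n : ℕ) (a : ℕ → LaurentSeries K)
    (f : Fin n → LaurentSeries K) (j : Fin n) :
    compT K n a f j = eulerD K (f j) + extZ f (j + 1) + a j * extZ f 0 := rfl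

/-- The iterated elimination operators. -/
noncomputable def elimS (K : Type*) [Field K] (a : ℕ → LaurentSeries K) :
    ℕ → (LaurentSeries K →ₗ[K] LaurentSeries K)
  | 0 => LinearMap.id
  | j + 1 => -(eulerD K ∘ₗ elimS K a j + LinearMap.mulLeft K (a j))

theorem elimS_succ {K : Type*} [Field K] (a : ℕ → LaurentSeries K) (j : ℕ) (z : LaurentSeries K) :
    elimS K a (j + 1) z = -(eulerD K (elimS K a j z) + a j * z) := rfl

theorem elimS_form {K : Type*} [Field K] (a : ℕ → LaurentSeries K) (j : ℕ) :
    ∃ b : ℕ → LaurentSeries K, b j ≠ 0 ∧ (∀ i, j < i → b i = 0) ∧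
      ∀ z, elimS K a j z = ∑ i ∈ Finset.range (j + 1), b i * ((eulerD K) ^ i) z := by
  induction j with
  | zero =>
    refine ⟨fun i => if i = 0 then 1 else 0, by simp, fun i hi => by simp [hi.ne'], fun z => ?_⟩
    simp [elimS]
  | succ j ih =>
    obtain ⟨b, hb, hb0, hz⟩ := ih
    refine ⟨fun i => Nat.casesOn i (-(eulerD K (b 0) + a j))
      (fun i => -(eulerD K (b (i + 1)) + b i)), ?_, ?_, ?_⟩
    · simp [hb0 (j + 1) (by omega), hb]
    · intro i hi
      cases i with
      | zero => omega
      | succ i => simp [hb0 (i + 1) (by omega), hb0 i (by omega)]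
    · intro z
      rw [elimS_succ, hz, map_sum, Finset.sum_range_succ' _ (j + 1)]
      have e1 : ∀ i, eulerD K (b i * ((eulerD K) ^ i) z) =
          eulerD K (b i) * ((eulerD K) ^ i) z + b i * ((eulerD K) ^ (i + 1)) z := by
        intro i
        rw [eulerD_mul, pow_succ', Module.End.mul_apply]
      simp only [e1, Finset.sum_add_distrib]
      have e2 : ∑ i ∈ Finset.range (j + 1), eulerD K (b i) * ((eulerD K) ^ i) z =
          ∑ i ∈ Finset.range (j + 1), eulerD K (b (i + 1)) * ((eulerD K) ^ (i + 1)) z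
            + eulerD K (b 0) * z := by
        have h1 := Finset.sum_range_succ (fun i => eulerD K (b i) * ((eulerD K) ^ i) z) (j + 1)
        have h2 := Finset.sum_range_succ' (fun i => eulerD K (b i) * ((eulerD K) ^ i) z) (j + 1)
        rw [h1, hb0 (j + 1) (by omega)] at h2
        simpa using h2
      rw [e2]
      simp only [neg_mul, add_mul, Finset.sum_neg_distrib, Finset.sum_add_distrib, pow_zero,
        Module.End.one_apply]
      change _ = _ + (-(eulerD K (b 0) + a j)) * z
      ring

theorem isFred_compT {K : Type*} [Field K] [CharZero K] (m : ℕ) (a : ℕ → LaurentSeries K) :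
    IsFred (compT K (m + 1) a) := by
  obtain ⟨b, hb, -, hz⟩ := elimS_form a (m + 1)
  obtain ⟨R0, fR, bR⟩ := isFred_scalar (elimS K a (m + 1)) (m + 1) b hb hz
  let R : (Fin (m + 1) → LaurentSeries K) →ₗ[K] (Fin (m + 1) → LaurentSeries K) :=
    -(LinearMap.single K (fun _ => LaurentSeries K) (Fin.last m) ∘ₗ R0 ∘ₗ LinearMap.proj 0)
  have hR : ∀ f, R f = -Pi.single (Fin.last m) (R0 (f 0)) := fun f => rfl
  have hlt : ∀ f (j : ℕ) (hj : j < m), (compT K (m + 1) a - R) f ⟨j, by omega⟩ =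
      eulerD K (extZ f j) + extZ f (j + 1) + a j * f 0 := by
    intro f j hj
    have : (⟨j, by omega⟩ : Fin (m + 1)) ≠ Fin.last m := by
      intro h; have := congrArg Fin.val h; simp at this; omega
    rw [LinearMap.sub_apply, Pi.sub_apply, compT_apply, hR, Pi.neg_apply, Pi.single_eq_of_ne this]
    rw [← extZ_fin f ⟨j, by omega⟩, ← extZ_fin f 0]
    simp
  have hlast : ∀ f, (compT K (m + 1) a - R) f (Fin.last m) =
      eulerD K (extZ f m) + a m * f 0 + R0 (f 0) := by
    intro f
    rw [LinearMap.sub_apply, Pi.sub_apply, compT_apply, hR, Pi.neg_apply, Pi.single_eq_same]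
    rw [← extZ_fin f (Fin.last m), ← extZ_fin f 0]
    have : extZ f (m + 1) = 0 := by simp [extZ]
    simp [this]
  refine ⟨R, ?_, ?_, ?_⟩
  · have : LinearMap.range R ≤ (LinearMap.range R0).map
        (LinearMap.single K (fun _ => LaurentSeries K) (Fin.last m)) := by
      rintro _ ⟨z, rfl⟩
      rw [hR]
      exact Submodule.neg_mem _ ⟨_, ⟨_, rfl⟩, rfl⟩
    exact Submodule.finiteDimensional_of_le this
  · rw [injective_iff_map_eq_zero]
    intro f hf
    have key : ∀ j, j ≤ m → extZ f j = elimS K a j (f 0) := by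
      intro j
      induction j with
      | zero => intro _; exact extZ_fin f 0
      | succ j ih =>
        intro hj
        have := hlt f j (by omega)
        rw [hf, Pi.zero_apply, ih (by omega)] at this
        rw [elimS_succ]
        linear_combination -this
    have h0 : f 0 = 0 := by
      apply (injective_iff_map_eq_zero _).1 bR.1
      have := hlast f
      rw [hf, Pi.zero_apply, key m le_rfl] at this
      rw [LinearMap.sub_apply, elimS_succ]
      linear_combination this
    funext j
    rw [← extZ_fin f j, key j (by omega), h0, map_zero, Pi.zero_apply]
  · intro g
    let q : ℕ → LaurentSeries K := fun n => Nat.rec 0 (fun j y => extZ g j - eulerD K y) n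
    have q0 : q 0 = 0 := rfl
    have qS : ∀ j, q (j + 1) = extZ g j - eulerD K (q j) := fun j => rfl
    obtain ⟨z, hzz⟩ := bR.2 (-q (m + 1))
    let f : Fin (m + 1) → LaurentSeries K := fun j => elimS K a j z + q j
    have hf : ∀ j, j ≤ m → extZ f j = elimS K a j z + q j := by
      intro j hj
      exact extZ_fin f ⟨j, by omega⟩
    have hf0 : f 0 = z := by
      change elimS K a 0 z + q 0 = z
      rw [q0, add_zero]; rfl
    refine ⟨f, ?_⟩
    funext j
    rcases Nat.lt_or_ge (j : ℕ) m with h | h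
    · have := hlt f j h
      rw [show (⟨(j : ℕ), by omega⟩ : Fin (m + 1)) = j from rfl] at this
      rw [this, hf0, hf _ h.le, hf _ h, elimS_succ, qS, extZ_fin, map_add]
      ring
    · obtain rfl : j = Fin.last m := Fin.ext (by simp; omega)
      rw [hlast, hf0, hf _ le_rfl, map_add]
      rw [LinearMap.sub_apply, elimS_succ, qS] at hzz
      have hg : extZ g m = g (Fin.last m) := extZ_fin g (Fin.last m)
      rw [hg] at hzz
      linear_combination -hzz

theorem isFred_conn {K : Type*} [Field K] [CharZero K] (d : ℕ) :
    ∀ (V : Type _) [AddCommGroup V] [Module K V] [Module (LaurentSeries K) V]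
      [IsScalarTower K (LaurentSeries K) V] [Module.Finite (LaurentSeries K) V]
      (D : V →ₗ[K] V) (_ : ∀ (f : LaurentSeries K) (v : V), D (f • v) = eulerD K f • v + f • D v),
      Module.finrank (LaurentSeries K) V = d → IsFred D := by
  induction d using Nat.strong_induction_on with
  | _ d ih =>
  intro V _ _ _ _ _ D hD hd
  rcases subsingleton_or_nontrivial V with hV | hV
  · refine ⟨0, ?_, ?_, ?_⟩
    · rw [LinearMap.range_zero]; infer_instance
    · intro a b _; exact Subsingleton.elim _ _
    · intro a; exact ⟨a, Subsingleton.elim _ _⟩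
  classical
  obtain ⟨v, hv⟩ := exists_ne (0 : V)
  let e : ℕ → V := fun n => (D ^ n) v
  have eS : ∀ n, D (e n) = e (n + 1) := by
    intro n
    simp only [e, pow_succ', Module.End.mul_apply]
  have hex : ∃ n : ℕ, ¬ LinearIndependent (LaurentSeries K) (fun i : Fin (n + 1) => e i) := by
    refine ⟨d, fun h => ?_⟩
    have := h.fintype_card_le_finrank
    rw [Fintype.card_fin, hd] at this
    omega
  obtain ⟨m, hm1, hm2⟩ : ∃ m : ℕ,
      LinearIndependent (LaurentSeries K) (fun i : Fin (m + 1) => e i) ∧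
      ¬ LinearIndependent (LaurentSeries K) (fun i : Fin (m + 1 + 1) => e i) := by
    have hs := Nat.find_spec hex
    have hmn := fun k => Nat.find_min hex (m := k)
    rcases hn : Nat.find hex with _ | m
    · exfalso
      rw [hn] at hs
      apply hs
      have h0 : LinearIndependent (LaurentSeries K) (fun i : Fin 1 => e i) := by
        rw [linearIndependent_unique_iff]
        simpa [e] using hv
      exact h0
    · refine ⟨m, not_not.1 (hmn m (by omega)), ?_⟩
      rw [hn] at hs
      exact hs
  have hspan : e (m + 1) ∈ Submodule.span (LaurentSeries K)
      (Set.range (fun i : Fin (m + 1) => e i)) := by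
    by_contra hc
    exact hm2 (linearIndependent_finSucc'.2 ⟨hm1, hc⟩)
  let w : Fin (m + 1) → V := fun j => e (m - j)
  have hw : w = (fun i : Fin (m + 1) => e i) ∘ Fin.rev := by
    funext j
    simp only [w, Function.comp, Fin.val_rev]
    congr 1
    omega
  have hwli : LinearIndependent (LaurentSeries K) w := by
    rw [hw]
    exact hm1.comp _ Fin.rev_injective
  have hwr : Set.range w = Set.range (fun i : Fin (m + 1) => e i) := by
    rw [hw, Fin.rev_surjective.range_comp]
  let E : (Fin (m + 1) → LaurentSeries K) →ₗ[LaurentSeries K] V :=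
    Fintype.linearCombination (LaurentSeries K) w
  have hE : ∀ f, E f = ∑ j ∈ Finset.range (m + 1), extZ f j • e (m - j) := by
    intro f
    rw [Finset.sum_range]
    simp only [extZ_fin]
    rfl
  have hEinj : Function.Injective E := hwli.fintypeLinearCombination_injective
  rw [← hwr, ← Fintype.range_linearCombination] at hspan
  obtain ⟨a, ha⟩ := hspan
  change E a = _ at ha
  have hcomm : ∀ f, D (E f) = E (compT K (m + 1) (extZ a) f) := by
    intro f
    have h1 : ∀ j ∈ Finset.range (m + 1), extZ (compT K (m + 1) (extZ a) f) j • e (m - j) =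
        eulerD K (extZ f j) • e (m - j) + extZ f (j + 1) • e (m - j)
          + extZ f 0 • (extZ a j • e (m - j)) := by
      intro j hj
      have hj' : j < m + 1 := Finset.mem_range.1 hj
      have := extZ_fin (compT K (m + 1) (extZ a) f) ⟨j, hj'⟩
      have h2 := extZ_fin f ⟨j, hj'⟩
      simp only at this h2
      rw [this, compT_apply, ← h2, smul_smul, add_smul, add_smul, mul_comm (extZ f 0)]
    have h3 : ∀ j ∈ Finset.range (m + 1), D (extZ f j • e (m - j)) =
        eulerD K (extZ f j) • e (m - j) + extZ f j • e (m + 1 - j) := by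
      intro j hj
      have hj' : j < m + 1 := Finset.mem_range.1 hj
      rw [hD, eS, show m - j + 1 = m + 1 - j by omega]
    rw [hE, hE, Finset.sum_congr rfl h1, map_sum, Finset.sum_congr rfl h3,
      Finset.sum_add_distrib, Finset.sum_add_distrib, Finset.sum_add_distrib, ← Finset.smul_sum,
      ← hE, ha, add_assoc]
    congr 1
    rw [Finset.sum_range_succ', Finset.sum_range_succ]
    have : extZ f (m + 1) = 0 := by simp [extZ]
    rw [this, zero_smul, add_zero]
    simp
  let M : Submodule (LaurentSeries K) V := LinearMap.range E
  have hDM : ∀ x ∈ M.restrictScalars K, D x ∈ M.restrictScalars K := by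
    rintro _ ⟨f, rfl⟩
    exact ⟨_, (hcomm f).symm⟩
  let DQ0 := (M.restrictScalars K).mapQ (M.restrictScalars K) D hDM
  let c := Submodule.Quotient.restrictScalarsEquiv K M
  let DQ : (V ⧸ M) →ₗ[K] (V ⧸ M) := c.toLinearMap ∘ₗ DQ0 ∘ₗ c.symm.toLinearMap
  let p : V →ₗ[K] (V ⧸ M) := M.mkQ.restrictScalars K
  have hp : Function.Surjective p := M.mkQ_surjective
  have hDQ : ∀ x, p (D x) = DQ (p x) := fun x => rfl
  have hQ : IsFred DQ := by
    have hlt : Module.finrank (LaurentSeries K) (V ⧸ M) < d := by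
      have h1 := M.finrank_quotient_add_finrank
      have h2 : Module.finrank (LaurentSeries K) M = m + 1 := by
        rw [LinearMap.finrank_range_of_inj hEinj]; simp
      omega
    refine ih _ hlt (V ⧸ M) DQ ?_ rfl
    intro f x
    obtain ⟨x, rfl⟩ := hp x
    have : f • p x = p (f • x) := rfl
    rw [this, ← hDQ, ← hDQ, hD]
    rfl
  refine isFred_extension (E.restrictScalars K) p hEinj hp ?_ (compT K (m + 1) (extZ a)) D DQ
    hcomm hDQ (isFred_compT m _) hQ
  intro x
  change M.mkQ x = 0 ↔ _
  simp only [Submodule.mkQ_apply, Submodule.Quotient.mk_eq_zero]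
  rfl

/-- Let `K` be a field of characteristic zero, `r ≥ 1`, `A` an `r × r` matrix over
`K((t))` and `h ∈ K((t))` nonzero.  The `K`-linear operator
`T f = h · (f' + A·f)` on `K((t))^r` (the operator `ν⁻¹ ∘ ∇_{K((t))/K}` attached to
the relative connection `∇ = d + A` and the form `ν = h⁻¹ dt`) is Fredholm of
index zero: its kernel and cokernel are finite-dimensional `K`-vector spaces of
the same dimension. -/
theorem connection_fredholm_index_zero (K : Type*) [Field K] [CharZero K]
    (r : ℕ) (hr : 1 ≤ r) (A : Matrix (Fin r) (Fin r) (LaurentSeries K))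
    (h : LaurentSeries K) (hh : h ≠ 0)
    (T : (Fin r → LaurentSeries K) →ₗ[K] (Fin r → LaurentSeries K))
    (hT : ∀ (f : Fin r → LaurentSeries K) (i : Fin r),
      T f i = h * (lsDeriv (f i) + ∑ j, A i j * f j)) :
    FiniteDimensional K (LinearMap.ker T) ∧
      FiniteDimensional K ((Fin r → LaurentSeries K) ⧸ LinearMap.range T) ∧
      Module.finrank K (LinearMap.ker T) =
        Module.finrank K ((Fin r → LaurentSeries K) ⧸ LinearMap.range T) := by
  let t : LaurentSeries K := HahnSeries.single 1 1
  have htd : ∀ f : LaurentSeries K, t * lsDeriv f = eulerD K f := by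
    intro f
    ext n
    rw [eulerD_coeff]
    have := HahnSeries.coeff_single_mul_add (r := (1 : K)) (x := lsDeriv f) (a := n - 1) (b := 1)
    rw [sub_add_cancel] at this
    rw [show (t * lsDeriv f).coeff n = _ from this]
    change 1 * ((n - 1 + 1) • f.coeff (n - 1 + 1)) = _
    rw [sub_add_cancel, one_mul, zsmul_eq_mul]
  have ht : t ≠ 0 := by simp [t]
  let u : LaurentSeries K := t * h⁻¹
  have hu : u ≠ 0 := mul_ne_zero ht (inv_ne_zero hh)
  let mu (x : LaurentSeries K) : (Fin r → LaurentSeries K) →ₗ[K] (Fin r → LaurentSeries K) :=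
    (LinearMap.lsmul (LaurentSeries K) (Fin r → LaurentSeries K) x).restrictScalars K
  have hmu : ∀ x f, mu x f = x • f := fun x f => rfl
  let D : (Fin r → LaurentSeries K) →ₗ[K] (Fin r → LaurentSeries K) := mu u ∘ₗ T
  have hDi : ∀ f i, D f i = eulerD K (f i) + t * ∑ j, A i j * f j := by
    intro f i
    change u * T f i = _
    rw [hT, ← htd]
    simp only [u]
    field_simp
  have hD : ∀ (f : LaurentSeries K) (v : Fin r → LaurentSeries K),
      D (f • v) = eulerD K f • v + f • D v := by
    intro f v
    funext i
    simp only [hDi, Pi.add_apply, Pi.smul_apply, smul_eq_mul, eulerD_mul]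
    have : ∑ j, A i j * (f * v j) = f * ∑ j, A i j * v j := by
      rw [Finset.mul_sum]
      exact Finset.sum_congr rfl fun j _ => by ring
    rw [this]
    ring
  obtain ⟨R, fR, bR⟩ := isFred_conn _ _ D hD rfl
  apply isFred_index
  refine ⟨mu u⁻¹ ∘ₗ R, ?_, ?_⟩
  · rw [LinearMap.range_comp]
    infer_instance
  · have : ∀ f, (T - mu u⁻¹ ∘ₗ R) f = u⁻¹ • ((D - R) f) := by
      intro f
      simp only [LinearMap.sub_apply, LinearMap.comp_apply, hmu, D, smul_sub]
      rw [inv_smul_smul₀ hu]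
    have h2 : ⇑(T - mu u⁻¹ ∘ₗ R) = (fun x => u⁻¹ • x) ∘ ⇑(D - R) := funext this
    rw [h2]
    refine Function.Bijective.comp ⟨?_, ?_⟩ bR
    · intro x y hxy
      exact (smul_right_injective _ (inv_ne_zero hu)) hxy
    · intro x
      exact ⟨u • x, inv_smul_smul₀ hu x⟩
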